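/- arXiv:2210.15277 — 8 statements merged into one kernel-verified Lean document; each statement's English description precedes it below -/
import Mathlib

section
/- For σ > 0, let G_σ be the Gaussian measure on ℝ with mean 0 and variance σ² conditioned on (i.e. restricted and renormalised to) the interval [−σ², σ²]. Then the function σ ↦ ∫∫ exp(−(x−y)²/2) dG_σ(x) dG_σ(y) is Θ(σ^{−1}) as σ → ∞; that is, there exist constants 0 < c ≤ C and σ₀ such that for all σ ≥ σ₀, c·σ^{−1} ≤ ∫∫ exp(−(x−y)²/2) dG_σ(x) dG_σ(y) ≤ C·σ^{−1}. -/
open MeasureTheory ProbabilityTheory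

/-- The Gaussian measure with mean `0` and variance `σ²`, conditioned (restricted and
renormalised) to the interval `[-σ², σ²]`. -/
noncomputable def truncGauss (σ : ℝ) : Measure ℝ :=
  (gaussianReal 0 (Real.toNNReal (σ ^ 2)))[|Set.Icc (-σ ^ 2) (σ ^ 2)]

open Real in
theorem gaussianPDFReal_zero_sq {σ : ℝ} (hσ : 0 < σ) (x : ℝ) :
    gaussianPDFReal 0 (σ ^ 2).toNNReal x = (√(2 * π))⁻¹ * σ⁻¹ * rexp (-x ^ 2 / (2 * σ ^ 2)) := by
  rw [gaussianPDFReal_def, Real.coe_toNNReal _ (sq_nonneg σ), Real.sqrt_mul (by positivity),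
    Real.sqrt_sq hσ.le, mul_inv]
  simp only [sub_zero]

theorem toNNReal_sq_ne_zero {σ : ℝ} (hσ : 0 < σ) : (σ ^ 2).toNNReal ≠ 0 :=
  (Real.toNNReal_pos.2 (by positivity)).ne'

open Real in
/-- Within one standard deviation, the density of a centred Gaussian is at least
`exp (-1 / 2) / (σ √(2π))`. -/
theorem le_gaussianReal_real_Icc {σ u v : ℝ} (hσ : 0 < σ) (hu : -σ ≤ u) (huv : u ≤ v)
    (hv : v ≤ σ) :
    (√(2 * π))⁻¹ * rexp (-1 / 2) * σ⁻¹ * (v - u)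
      ≤ (gaussianReal 0 (σ ^ 2).toNNReal).real (Set.Icc u v) := by
  have hnn : 0 ≤ ∫ x in Set.Icc u v, gaussianPDFReal 0 (σ ^ 2).toNNReal x :=
    integral_nonneg fun x => gaussianPDFReal_nonneg _ _ x
  rw [measureReal_def, gaussianReal_apply_eq_integral _ (toNNReal_sq_ne_zero hσ),
    ENNReal.toReal_ofReal hnn]
  have h := setIntegral_mono_on (μ := volume) (s := Set.Icc u v)
    (f := fun _ => (√(2 * π))⁻¹ * rexp (-1 / 2) * σ⁻¹)
    (integrableOn_const (by simp))
    (integrable_gaussianPDFReal 0 (σ ^ 2).toNNReal).integrableOn measurableSet_Icc ?_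
  · rw [setIntegral_const, Real.volume_real_Icc_of_le huv, smul_eq_mul] at h
    linarith
  · intro x hx
    rw [gaussianPDFReal_zero_sq hσ, mul_right_comm]
    refine mul_le_mul_of_nonneg_left (Real.exp_le_exp.2 ?_) (by positivity)
    rw [div_le_div_iff₀ (by norm_num) (by positivity)]
    have : x ^ 2 ≤ σ ^ 2 := sq_le_sq' (hu.trans hx.1) (hx.2.trans hv)
    linarith

open Real in
/-- A centred Gaussian has density at most `1 / (σ √(2π))`. -/
theorem integral_gaussianReal_le {σ : ℝ} (hσ : 0 < σ) {g : ℝ → ℝ} (hg : Integrable g)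
    (hg0 : 0 ≤ g) :
    ∫ x, g x ∂(gaussianReal 0 (σ ^ 2).toNNReal) ≤ (√(2 * π))⁻¹ * σ⁻¹ * ∫ x, g x := by
  rw [integral_gaussianReal_eq_integral_smul (toNNReal_sq_ne_zero hσ), ← integral_const_mul]
  refine integral_mono_of_nonneg
    (.of_forall fun x => mul_nonneg (gaussianPDFReal_nonneg _ _ x) (hg0 x))
    (hg.const_mul _) (.of_forall fun x => ?_)
  simp only [smul_eq_mul, gaussianPDFReal_zero_sq hσ]
  refine mul_le_mul_of_nonneg_right ?_ (hg0 x)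
  refine mul_le_of_le_one_right (by positivity) (Real.exp_le_one_iff.2 ?_)
  exact div_nonpos_of_nonpos_of_nonneg (by nlinarith [sq_nonneg x]) (by positivity)

theorem const_mul_measureReal_le_integral {α : Type*} [MeasurableSpace α] {μ : Measure α}
    [IsFiniteMeasure μ] {g : α → ℝ} (hg : Integrable g μ) (hg0 : 0 ≤ g) {s : Set α}
    (hs : MeasurableSet s) {c : ℝ} (hc : ∀ x ∈ s, c ≤ g x) : c * μ.real s ≤ ∫ x, g x ∂μ := by
  have h := setIntegral_mono_on (integrableOn_const (measure_ne_top μ s)) hg.integrableOn hs hc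
  rw [setIntegral_const, smul_eq_mul, mul_comm] at h
  exact h.trans (setIntegral_le_integral hg (.of_forall hg0))

theorem measureReal_le_cond_of_subset {α : Type*} [MeasurableSpace α] {μ : Measure α}
    [IsProbabilityMeasure μ] {s t : Set α} (hs : MeasurableSet s) (hs0 : μ s ≠ 0) (hts : t ⊆ s) :
    μ.real t ≤ (μ[|s]).real t := by
  rw [measureReal_def (μ[|s]), cond_apply hs, Set.inter_eq_self_of_subset_right hts,
    ENNReal.toReal_mul, ENNReal.toReal_inv]
  refine le_mul_of_one_le_left measureReal_nonneg ((one_le_inv₀ ?_).2 measureReal_le_one)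
  exact ENNReal.toReal_pos hs0 (measure_ne_top _ _)

theorem integrable_exp_neg_sub_sq (x : ℝ) :
    Integrable fun y : ℝ => Real.exp (-(x - y) ^ 2 / 2) := by
  have h := (integrable_exp_neg_mul_sq (b := 1 / 2) (by norm_num)).comp_sub_left x
  refine h.congr (.of_forall fun y => ?_)
  simp only
  congr 1
  ring

theorem integral_exp_neg_sub_sq (x : ℝ) :
    ∫ y : ℝ, Real.exp (-(x - y) ^ 2 / 2) = √(2 * Real.pi) := by
  rw [integral_sub_left_eq_self (fun z : ℝ => Real.exp (-z ^ 2 / 2)) volume x]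
  have h := integral_gaussian (1 / 2)
  rw [show Real.pi / (1 / 2) = 2 * Real.pi by ring] at h
  rw [← h]
  congr 1 with z
  congr 1
  ring

theorem exp_neg_sub_sq_le_one (x y : ℝ) : Real.exp (-(x - y) ^ 2 / 2) ≤ 1 :=
  Real.exp_le_one_iff.2 (by nlinarith [sq_nonneg (x - y)])

theorem integrable_exp_neg_sub_sq_measure (μ : Measure ℝ) [IsFiniteMeasure μ] (x : ℝ) :
    Integrable (fun y : ℝ => Real.exp (-(x - y) ^ 2 / 2)) μ := by
  refine .of_bound (by fun_prop) 1 (.of_forall fun y => ?_)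
  rw [Real.norm_of_nonneg (Real.exp_nonneg _)]
  exact exp_neg_sub_sq_le_one x y

theorem integrable_integral_exp_neg_sub_sq (μ : Measure ℝ) [IsFiniteMeasure μ] :
    Integrable (fun x : ℝ => ∫ y, Real.exp (-(x - y) ^ 2 / 2) ∂μ) μ := by
  refine Integrable.integral_prod_left
    (f := fun z : ℝ × ℝ => Real.exp (-(z.1 - z.2) ^ 2 / 2)) (ν := μ) ?_
  refine .of_bound (by fun_prop) 1 (.of_forall fun z => ?_)
  rw [Real.norm_of_nonneg (Real.exp_nonneg _)]
  exact exp_neg_sub_sq_le_one z.1 z.2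

/-- The sparsity factor `ρ_σ = ∫∫ exp(−(x−y)²/2) dG_σ(x) dG_σ(y)`, where `G_σ` is the truncated
Gaussian, is `Θ(σ⁻¹)` as `σ → ∞`. -/
theorem truncated_gaussian_rbf_sparsity_theta :
    ∃ c C σ₀ : ℝ, 0 < c ∧ c ≤ C ∧ ∀ σ : ℝ, σ₀ ≤ σ →
      c * σ⁻¹ ≤ (∫ x, ∫ y, Real.exp (-(x - y) ^ 2 / 2) ∂(truncGauss σ) ∂(truncGauss σ)) ∧
      (∫ x, ∫ y, Real.exp (-(x - y) ^ 2 / 2) ∂(truncGauss σ) ∂(truncGauss σ)) ≤ C * σ⁻¹ := by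
  set a : ℝ := (√(2 * Real.pi))⁻¹ * Real.exp (-1 / 2) with ha
  have ha0 : 0 < a := by positivity
  suffices H : ∀ σ : ℝ, 1 ≤ σ →
      Real.exp (-1 / 2) * a * (2 * a) * σ⁻¹
        ≤ (∫ x, ∫ y, Real.exp (-(x - y) ^ 2 / 2) ∂(truncGauss σ) ∂(truncGauss σ)) ∧
      (∫ x, ∫ y, Real.exp (-(x - y) ^ 2 / 2) ∂(truncGauss σ) ∂(truncGauss σ))
        ≤ (2 * a)⁻¹ * σ⁻¹ by
    refine ⟨_, _, 1, by positivity, ?_, H⟩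
    simpa using (H 1 le_rfl).1.trans (H 1 le_rfl).2
  intro σ hσ
  have hσ0 : 0 < σ := by linarith
  have hsub : Set.Icc (-σ) σ ⊆ Set.Icc (-σ ^ 2) (σ ^ 2) :=
    Set.Icc_subset_Icc (by nlinarith) (by nlinarith)
  have hcore : 2 * a ≤ (gaussianReal 0 (σ ^ 2).toNNReal).real (Set.Icc (-σ) σ) := by
    have h := le_gaussianReal_real_Icc hσ0 le_rfl (by linarith) (le_refl σ)
    rw [← ha] at h
    convert h using 1
    field_simp
    ring
  have hmass : 2 * a ≤ (gaussianReal 0 (σ ^ 2).toNNReal).real (Set.Icc (-σ ^ 2) (σ ^ 2)) :=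
    hcore.trans (measureReal_mono hsub)
  have hne : gaussianReal 0 (σ ^ 2).toNNReal (Set.Icc (-σ ^ 2) (σ ^ 2)) ≠ 0 := by
    intro h
    rw [measureReal_def, h, ENNReal.toReal_zero] at hmass
    linarith
  have : IsProbabilityMeasure (truncGauss σ) := cond_isProbabilityMeasure hne
  have hle {t : Set ℝ} (ht : t ⊆ Set.Icc (-σ) σ) :
      (gaussianReal 0 (σ ^ 2).toNNReal).real t ≤ (truncGauss σ).real t :=
    measureReal_le_cond_of_subset measurableSet_Icc hne (ht.trans hsub)
  constructor
  · have hinner : ∀ x ∈ Set.Icc (-σ) σ, Real.exp (-1 / 2) * (a * σ⁻¹)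
        ≤ ∫ y, Real.exp (-(x - y) ^ 2 / 2) ∂(truncGauss σ) := by
      intro x hx
      obtain ⟨u, hu, huσ, hxu, hux⟩ : ∃ u, -σ ≤ u ∧ u + 1 ≤ σ ∧ u ≤ x ∧ x ≤ u + 1 := by
        rcases le_total 0 x with h | h
        · exact ⟨x - 1, by linarith, by linarith [hx.2], by linarith, by linarith⟩
        · exact ⟨x, hx.1, by linarith, le_rfl, by linarith⟩
      have hI := le_gaussianReal_real_Icc hσ0 hu (by linarith : u ≤ u + 1) huσ
      rw [add_sub_cancel_left, mul_one] at hI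
      refine (mul_le_mul_of_nonneg_left (hI.trans (hle (Set.Icc_subset_Icc hu huσ)))
        (Real.exp_nonneg _)).trans (const_mul_measureReal_le_integral
          (integrable_exp_neg_sub_sq_measure _ x) (fun y => Real.exp_nonneg _)
          measurableSet_Icc fun y hy => Real.exp_le_exp.2 ?_)
      have : (x - y) ^ 2 ≤ 1 := by
        rw [sq_le_one_iff_abs_le_one, abs_le]
        constructor <;> linarith [hy.1, hy.2]
      linarith
    refine le_trans ?_ (const_mul_measureReal_le_integral
      (integrable_integral_exp_neg_sub_sq (truncGauss σ))
      (fun x => integral_nonneg fun y => Real.exp_nonneg _) measurableSet_Icc hinner)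
    calc Real.exp (-1 / 2) * a * (2 * a) * σ⁻¹
        = Real.exp (-1 / 2) * (a * σ⁻¹) * (2 * a) := by ring
      _ ≤ _ := by
        gcongr
        exact hcore.trans (hle subset_rfl)
  · have hinner (x : ℝ) :
        ∫ y, Real.exp (-(x - y) ^ 2 / 2) ∂(truncGauss σ) ≤ (2 * a)⁻¹ * σ⁻¹ := by
      have hset := (setIntegral_le_integral (s := Set.Icc (-σ ^ 2) (σ ^ 2))
        (integrable_exp_neg_sub_sq_measure (gaussianReal 0 (σ ^ 2).toNNReal) x)
        (.of_forall fun y => Real.exp_nonneg _)).trans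
        (integral_gaussianReal_le hσ0 (integrable_exp_neg_sub_sq x) fun y => Real.exp_nonneg _)
      rw [integral_exp_neg_sub_sq, mul_right_comm, inv_mul_cancel₀ (by positivity),
        one_mul] at hset
      rw [truncGauss, ProbabilityTheory.cond, integral_smul_measure, ENNReal.toReal_inv,
        smul_eq_mul]
      exact mul_le_mul (inv_anti₀ (by positivity) hmass) hset
        (integral_nonneg fun y => Real.exp_nonneg _) (by positivity)
    simpa using integral_mono (integrable_integral_exp_neg_sub_sq (truncGauss σ))
      (integrable_const _) hinner
end

section
/- For σ > 0, set s = 1 + 2σ² + √(1 + 4σ²), r = 2σ²/s, and γ_k = √(2/s) · r^{k−1} for k = 1, 2, …. Then the function σ ↦ ∑_{k=1}^{∞} γ_k³ is Θ(σ^{−2}) as σ → ∞; that is, there exist constants 0 < c ≤ C and σ₀ such that for all σ ≥ σ₀, c·σ^{−2} ≤ ∑_{k=1}^{∞} γ_k³ ≤ C·σ^{−2}. -/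
/-- `s σ = 1 + 2σ² + √(1 + 4σ²)`. -/
noncomputable def sRBF (σ : ℝ) : ℝ := 1 + 2 * σ ^ 2 + Real.sqrt (1 + 4 * σ ^ 2)

/-- `r σ = 2σ²/s σ`, the common ratio of the eigenvalues of the Gaussian RBF integral
operator with respect to `N(0, σ²)`. -/
noncomputable def rRBF (σ : ℝ) : ℝ := 2 * σ ^ 2 / sRBF σ

/-- The eigenvalues `γ_k = √(2/s)·r^{k−1}`, `k = 1, 2, …`, indexed here by `k : ℕ`
(so `gammaRBF σ k = γ_{k+1}`). -/
noncomputable def gammaRBF (σ : ℝ) (k : ℕ) : ℝ := Real.sqrt (2 / sRBF σ) * rRBF σ ^ k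

theorem sRBF_eq (σ : ℝ) : sRBF σ = (√(1 + 4 * σ ^ 2) + 1) ^ 2 / 2 := by
  have h : √(1 + 4 * σ ^ 2) ^ 2 = 1 + 4 * σ ^ 2 := Real.sq_sqrt (by positivity)
  rw [sRBF]
  linear_combination -h / 2

theorem sqrt_two_div_sRBF (σ : ℝ) : √(2 / sRBF σ) = 2 / (√(1 + 4 * σ ^ 2) + 1) := by
  rw [sRBF_eq, show 2 / ((√(1 + 4 * σ ^ 2) + 1) ^ 2 / 2) = (2 / (√(1 + 4 * σ ^ 2) + 1)) ^ 2 by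
    field_simp]
  exact Real.sqrt_sq (by positivity)

theorem rRBF_eq (σ : ℝ) : rRBF σ = (√(1 + 4 * σ ^ 2) - 1) / (√(1 + 4 * σ ^ 2) + 1) := by
  have h : √(1 + 4 * σ ^ 2) ^ 2 = 1 + 4 * σ ^ 2 := Real.sq_sqrt (by positivity)
  have hpos : 0 < √(1 + 4 * σ ^ 2) + 1 := by positivity
  rw [rRBF, sRBF_eq, div_eq_div_iff (by positivity) hpos.ne']
  linear_combination -(√(1 + 4 * σ ^ 2) + 1) / 2 * h

theorem rRBF_nonneg (σ : ℝ) : 0 ≤ rRBF σ := by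
  unfold rRBF sRBF
  positivity

theorem rRBF_lt_one (σ : ℝ) : rRBF σ < 1 := by
  rw [rRBF_eq, div_lt_one (by positivity)]
  linarith

/-- The cubed eigenvalues form a geometric series with an explicit rational sum. -/
theorem hasSum_gammaRBF_cube (σ : ℝ) :
    HasSum (fun k : ℕ => gammaRBF σ k ^ 3) (1 / (1 + 3 * σ ^ 2)) := by
  have hgeom := (hasSum_geometric_of_lt_one (pow_nonneg (rRBF_nonneg σ) 3)
    (pow_lt_one₀ (rRBF_nonneg σ) (rRBF_lt_one σ) three_ne_zero)).mul_left (√(2 / sRBF σ) ^ 3)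
  have hsum : √(2 / sRBF σ) ^ 3 * (1 - rRBF σ ^ 3)⁻¹ = 1 / (1 + 3 * σ ^ 2) := by
    have h : √(1 + 4 * σ ^ 2) ^ 2 = 1 + 4 * σ ^ 2 := Real.sq_sqrt (by positivity)
    have hpos : 0 < √(1 + 4 * σ ^ 2) + 1 := by positivity
    rw [sqrt_two_div_sRBF, rRBF_eq]
    generalize √(1 + 4 * σ ^ 2) = t at h hpos
    have hden : 1 - ((t - 1) / (t + 1)) ^ 3 = 8 * (1 + 3 * σ ^ 2) / (t + 1) ^ 3 := by
      field_simp
      linear_combination 6 * h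
    rw [hden]
    field_simp
    norm_num
  rw [hsum] at hgeom
  simpa only [gammaRBF, mul_pow, pow_right_comm] using hgeom

/-- The sum of cubed eigenvalues `∑_{k=1}^∞ γ_k³` of the Gaussian RBF integral operator
is `Θ(σ⁻²)` as `σ → ∞`. -/
theorem rbf_eigenvalue_cube_sum_theta :
    ∃ c C σ₀ : ℝ, 0 < c ∧ c ≤ C ∧ ∀ σ : ℝ, σ₀ ≤ σ →
      c / σ ^ 2 ≤ (∑' k : ℕ, gammaRBF σ k ^ 3) ∧
      (∑' k : ℕ, gammaRBF σ k ^ 3) ≤ C / σ ^ 2 := by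
  refine ⟨1 / 4, 1, 1, by norm_num, by norm_num, fun σ hσ => ?_⟩
  rw [(hasSum_gammaRBF_cube σ).tsum_eq]
  have hσ2 : 1 ≤ σ ^ 2 := one_le_pow₀ hσ
  constructor
  · rw [div_le_div_iff₀ (by positivity) (by positivity)]
    linarith
  · rw [div_le_div_iff₀ (by positivity) (by positivity)]
    linarith
end

section
/- Let r > 0 and let x ∈ ℝ² with ‖x‖ = r. Then (1/(2π)) ∫_0^{2π} exp(−‖x − (r cos θ, r sin θ)‖²/2) dθ < 1/r. -/
open Real

/-- The point `(r cos θ, r sin θ)` on the circle of radius `r` in Euclidean `ℝ²`. -/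
noncomputable def circlePoint (r θ : ℝ) : EuclideanSpace ℝ (Fin 2) :=
  (EuclideanSpace.equiv (Fin 2) ℝ).symm ![r * Real.cos θ, r * Real.sin θ]

/-- A vector of Euclidean `ℝ²` of norm `r` has polar coordinates `(r, t)` for some angle `t`. -/
lemma exists_polar_angle (r : ℝ) (x : EuclideanSpace ℝ (Fin 2)) (hx : ‖x‖ = r) :
    ∃ t : ℝ, x 0 = r * cos t ∧ x 1 = r * sin t := by
  have hz : ‖(⟨x 0, x 1⟩ : ℂ)‖ = r := by
    rw [← hx, EuclideanSpace.norm_eq, Complex.norm_eq_sqrt_sq_add_sq]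
    simp
  refine ⟨Complex.arg ⟨x 0, x 1⟩, ?_, ?_⟩
  · rw [← hz, Complex.norm_mul_cos_arg]
  · rw [← hz, Complex.norm_mul_sin_arg]

lemma norm_sub_circlePoint_sq (r t θ : ℝ) (x : EuclideanSpace ℝ (Fin 2))
    (h0 : x 0 = r * cos t) (h1 : x 1 = r * sin t) :
    ‖x - circlePoint r θ‖ ^ 2 = 2 * (r ^ 2 * (1 - cos (θ - t))) := by
  rw [EuclideanSpace.norm_sq_eq]
  simp only [Fin.sum_univ_two, norm_eq_abs, sq_abs, PiLp.sub_apply, h0, h1, circlePoint,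
    cos_sub]
  simp
  linear_combination r ^ 2 * sin_sq_add_cos_sq t + r ^ 2 * sin_sq_add_cos_sq θ

lemma integral_exp_cos_sub (r t : ℝ) :
    ∫ θ in (0 : ℝ)..(2 * π), exp (-(r ^ 2 * (1 - cos (θ - t)))) =
      ∫ θ in (-π)..π, exp (-(r ^ 2 * (1 - cos θ))) := by
  have hper : Function.Periodic (fun θ : ℝ => exp (-(r ^ 2 * (1 - cos θ)))) (2 * π) :=
    fun θ => by simp only [cos_add_two_pi]
  rw [intervalIntegral.integral_comp_sub_right (fun θ => exp (-(r ^ 2 * (1 - cos θ)))) t]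
  have h := hper.intervalIntegral_add_eq (0 - t) (-π)
  rwa [show 0 - t + 2 * π = 2 * π - t by ring, show -π + 2 * π = π by ring] at h

lemma integral_exp_cos_le (r : ℝ) (hr : 0 < r) :
    ∫ θ in (-π)..π, exp (-(r ^ 2 * (1 - cos θ))) ≤ √(π / (2 * r ^ 2 / π ^ 2)) := by
  have hb : 0 < 2 * r ^ 2 / π ^ 2 := by positivity
  have hle : -π ≤ π := by linarith [pi_pos]
  calc ∫ θ in (-π)..π, exp (-(r ^ 2 * (1 - cos θ)))
      ≤ ∫ θ in (-π)..π, exp (-(2 * r ^ 2 / π ^ 2) * θ ^ 2) := by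
        refine intervalIntegral.integral_mono_on hle
          (Continuous.intervalIntegrable (by fun_prop) _ _)
          (Continuous.intervalIntegrable (by fun_prop) _ _) fun θ hθ => ?_
        have hc := cos_le_one_sub_mul_cos_sq (abs_le.2 hθ)
        have hmul := mul_le_mul_of_nonneg_left hc (sq_nonneg r)
        rw [exp_le_exp]
        calc -(r ^ 2 * (1 - cos θ)) ≤ -(r ^ 2 * (2 / π ^ 2 * θ ^ 2)) := by linarith
          _ = -(2 * r ^ 2 / π ^ 2) * θ ^ 2 := by ring
    _ ≤ ∫ θ : ℝ, exp (-(2 * r ^ 2 / π ^ 2) * θ ^ 2) := by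
        rw [intervalIntegral.integral_of_le hle]
        exact MeasureTheory.setIntegral_le_integral (integrable_exp_neg_mul_sq hb)
          (Filter.Eventually.of_forall fun θ => (exp_pos _).le)
    _ = √(π / (2 * r ^ 2 / π ^ 2)) := integral_gaussian _

/-- For `r > 0` and `x` on the circle of radius `r` in `ℝ²`, the average of the Gaussian RBF
kernel over the uniform distribution on the circle is strictly less than `1/r`. -/
theorem circle_rbf_sparsity_lt (r : ℝ) (hr : 0 < r) (x : EuclideanSpace ℝ (Fin 2))
    (hx : ‖x‖ = r) :
    (1 / (2 * π)) * ∫ θ in (0:ℝ)..(2 * π),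
        Real.exp (-‖x - circlePoint r θ‖ ^ 2 / 2)
      < 1 / r := by
  obtain ⟨t, h0, h1⟩ := exists_polar_angle r x hx
  have hcongr : ∀ θ : ℝ, exp (-‖x - circlePoint r θ‖ ^ 2 / 2) =
      exp (-(r ^ 2 * (1 - cos (θ - t)))) := fun θ => by
    rw [norm_sub_circlePoint_sq r t θ x h0 h1]
    congr 1
    ring
  simp only [hcongr]
  rw [integral_exp_cos_sub]
  have hsqrt : √(π / (2 * r ^ 2 / π ^ 2)) < 2 * π / r := by
    rw [sqrt_lt' (by positivity)]
    calc π / (2 * r ^ 2 / π ^ 2) = π ^ 2 / r ^ 2 * (π / 2) := by field_simp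
      _ < π ^ 2 / r ^ 2 * 4 := by
        have := pi_lt_four
        gcongr
        linarith
      _ = (2 * π / r) ^ 2 := by ring
  calc 1 / (2 * π) * ∫ θ in (-π)..π, exp (-(r ^ 2 * (1 - cos θ)))
      < 1 / (2 * π) * (2 * π / r) := by
        gcongr
        exact (integral_exp_cos_le r hr).trans_lt hsqrt
    _ = 1 / r := by field_simp
end

section
/- Let r ≥ 1 and for θ ∈ [0, 2π] write p(θ) = (r cos θ, r sin θ) ∈ ℝ². Then (1/(2π)³) ∫_0^{2π} ∫_0^{2π} ∫_0^{2π} exp(−(‖p(θ₁)−p(θ₂)‖² + ‖p(θ₂)−p(θ₃)‖² + ‖p(θ₃)−p(θ₁)‖²)/2) dθ₁ dθ₂ dθ₃ ≥ 1/(8√3·π·r²). -/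
open Real

theorem norm_circlePoint_sub_sq (r x y : ℝ) :
    ‖circlePoint r x - circlePoint r y‖ ^ 2 = 2 * r ^ 2 * (1 - Real.cos (x - y)) := by
  rw [EuclideanSpace.norm_sq_eq, Fin.sum_univ_two]
  simp only [circlePoint, PiLp.continuousLinearEquiv_symm_apply, PiLp.sub_apply,
    Matrix.cons_val_zero, Matrix.cons_val_one, Real.norm_eq_abs, sq_abs, Real.cos_sub]
  linear_combination r ^ 2 * Real.sin_sq_add_cos_sq x + r ^ 2 * Real.sin_sq_add_cos_sq y

theorem continuous_circlePoint (r : ℝ) : Continuous (circlePoint r) := by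
  unfold circlePoint
  refine (EuclideanSpace.equiv (Fin 2) ℝ).symm.continuous.comp (continuous_pi fun i => ?_)
  fin_cases i <;> simp <;> fun_prop

theorem circlePoint_add_two_pi (r x : ℝ) : circlePoint r (x + 2 * π) = circlePoint r x := by
  simp [circlePoint]

theorem norm_circlePoint_sub_sq_le (r x y : ℝ) :
    ‖circlePoint r x - circlePoint r y‖ ^ 2 ≤ r ^ 2 * (x - y) ^ 2 := by
  rw [norm_circlePoint_sub_sq]
  nlinarith [Real.one_sub_sq_div_two_le_cos (x := x - y), sq_nonneg r]

/-- The product of the three pairwise Gaussian kernels at points of the circle of radius `r`. -/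
noncomputable def triangleKernel (r x y z : ℝ) : ℝ :=
  Real.exp (-(‖circlePoint r x - circlePoint r y‖ ^ 2 +
    ‖circlePoint r y - circlePoint r z‖ ^ 2 + ‖circlePoint r z - circlePoint r x‖ ^ 2) / 2)

theorem Continuous.triangleKernel {X : Type*} [TopologicalSpace X] (r : ℝ) {f g h : X → ℝ}
    (hf : Continuous f) (hg : Continuous g) (hh : Continuous h) :
    Continuous fun t => triangleKernel r (f t) (g t) (h t) := by
  have := continuous_circlePoint r
  unfold _root_.triangleKernel
  fun_prop

theorem triangleKernel_nonneg (r x y z : ℝ) : 0 ≤ triangleKernel r x y z :=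
  (Real.exp_pos _).le

theorem one_sub_le_triangleKernel (r x y z : ℝ) :
    1 - r ^ 2 * ((y - x) ^ 2 - (y - x) * (z - x) + (z - x) ^ 2) ≤ triangleKernel r x y z := by
  refine le_trans ?_ (Real.add_one_le_exp _)
  linarith [norm_circlePoint_sub_sq_le r x y, norm_circlePoint_sub_sq_le r y z,
    norm_circlePoint_sub_sq_le r z x]

theorem integral_symm_interval_le_of_periodic {f : ℝ → ℝ} (hf : Continuous f)
    (hp : Function.Periodic f (2 * π)) (h0 : ∀ t, 0 ≤ f t) {δ : ℝ} (hδ : 0 ≤ δ) (hδπ : δ ≤ π)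
    (x : ℝ) : ∫ t in (x - δ)..(x + δ), f t ≤ ∫ t in (0 : ℝ)..(2 * π), f t := by
  have h := hp.intervalIntegral_add_eq 0 (x - π)
  rw [zero_add] at h
  rw [h]
  exact intervalIntegral.integral_mono_interval (by linarith) (by linarith) (by linarith)
    (Filter.Eventually.of_forall h0) (hf.intervalIntegrable _ _)

theorem integral_symm_interval_quadratic (a b c x δ : ℝ) :
    ∫ t in (x - δ)..(x + δ), (a + b * (t - x) + c * (t - x) ^ 2) =
      2 * δ * a + 2 * δ ^ 3 / 3 * c := by
  rw [intervalIntegral.integral_comp_sub_right (fun t => a + b * t + c * t ^ 2) x,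
    intervalIntegral.integral_add (Continuous.intervalIntegrable (by fun_prop) _ _)
      (Continuous.intervalIntegrable (by fun_prop) _ _),
    intervalIntegral.integral_add (Continuous.intervalIntegrable (by fun_prop) _ _)
      (Continuous.intervalIntegrable (by fun_prop) _ _),
    intervalIntegral.integral_const_mul, intervalIntegral.integral_const_mul, integral_id,
    integral_pow, intervalIntegral.integral_const, smul_eq_mul]
  push_cast
  ring

theorem le_integral_triangleKernel {r δ : ℝ} (hδ : 0 ≤ δ) (hδπ : δ ≤ π) (x y : ℝ) :
    2 * δ * (1 - r ^ 2 * (y - x) ^ 2) - 2 * δ ^ 3 / 3 * r ^ 2 ≤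
      ∫ z in (0 : ℝ)..(2 * π), triangleKernel r x y z := by
  have hc : Continuous (triangleKernel r x y) :=
    Continuous.triangleKernel r continuous_const continuous_const continuous_id
  have hp : Function.Periodic (triangleKernel r x y) (2 * π) := fun z => by
    simp only [triangleKernel, circlePoint_add_two_pi]
  refine le_trans ?_ (integral_symm_interval_le_of_periodic hc hp
    (triangleKernel_nonneg r x y) hδ hδπ x)
  calc _ = ∫ z in (x - δ)..(x + δ), ((1 - r ^ 2 * (y - x) ^ 2) + r ^ 2 * (y - x) * (z - x) +
          (-r ^ 2) * (z - x) ^ 2) := by rw [integral_symm_interval_quadratic]; ring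
    _ ≤ _ := by
      refine intervalIntegral.integral_mono_on (by linarith)
        (Continuous.intervalIntegrable (by fun_prop) _ _) (hc.intervalIntegrable _ _)
        fun z _ => ?_
      linarith [one_sub_le_triangleKernel r x y z]

theorem continuous_integral_triangleKernel (r : ℝ) :
    Continuous fun p : ℝ × ℝ => ∫ z in (0 : ℝ)..(2 * π), triangleKernel r p.1 p.2 z := by
  have h : Continuous (Function.uncurry fun (p : ℝ × ℝ) z => triangleKernel r p.1 p.2 z) :=
    Continuous.triangleKernel r (by fun_prop) (by fun_prop) (by fun_prop)
  exact intervalIntegral.continuous_parametric_intervalIntegral_of_continuous' h _ _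

theorem le_integral_integral_triangleKernel {r δ : ℝ} (hδ : 0 ≤ δ) (hδπ : δ ≤ π) (x : ℝ) :
    4 * δ ^ 2 - 8 * δ ^ 4 / 3 * r ^ 2 ≤
      ∫ y in (0 : ℝ)..(2 * π), ∫ z in (0 : ℝ)..(2 * π), triangleKernel r x y z := by
  have hc : Continuous fun y => ∫ z in (0 : ℝ)..(2 * π), triangleKernel r x y z := by
    have h := (continuous_integral_triangleKernel r).comp (Continuous.prodMk_right x)
    exact h
  have hp : Function.Periodic (fun y => ∫ z in (0 : ℝ)..(2 * π), triangleKernel r x y z)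
      (2 * π) := fun y => by
    simp only [triangleKernel, circlePoint_add_two_pi]
  refine le_trans ?_ (integral_symm_interval_le_of_periodic hc hp (fun _ =>
    intervalIntegral.integral_nonneg (by positivity)
      fun _ _ => triangleKernel_nonneg _ _ _ _) hδ hδπ x)
  calc _ = ∫ y in (x - δ)..(x + δ), ((2 * δ - 2 * δ ^ 3 / 3 * r ^ 2) + 0 * (y - x) +
          (-2 * δ * r ^ 2) * (y - x) ^ 2) := by rw [integral_symm_interval_quadratic]; ring
    _ ≤ _ := by
      refine intervalIntegral.integral_mono_on (by linarith)
        (Continuous.intervalIntegrable (by fun_prop) _ _) (hc.intervalIntegrable _ _)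
        fun y _ => ?_
      linarith [le_integral_triangleKernel (r := r) hδ hδπ x y]

/-- For `r ≥ 1`, the triple integral of the product of Gaussian RBF kernels over the uniform
distribution on the circle of radius `r` is at least `1/(8√3·π·r²)`. -/
theorem circle_rbf_triangle_lower_bound (r : ℝ) (hr : 1 ≤ r) :
    (1 / (2 * π) ^ 3) * ∫ θ₁ in (0:ℝ)..(2 * π), ∫ θ₂ in (0:ℝ)..(2 * π), ∫ θ₃ in (0:ℝ)..(2 * π),
        Real.exp (-(‖circlePoint r θ₁ - circlePoint r θ₂‖ ^ 2 +
            ‖circlePoint r θ₂ - circlePoint r θ₃‖ ^ 2 +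
            ‖circlePoint r θ₃ - circlePoint r θ₁‖ ^ 2) / 2)
      ≥ 1 / (8 * Real.sqrt 3 * π * r ^ 2) := by
  change 1 / (8 * Real.sqrt 3 * π * r ^ 2) ≤ (1 / (2 * π) ^ 3) * ∫ x in (0:ℝ)..(2 * π),
    ∫ y in (0:ℝ)..(2 * π), ∫ z in (0:ℝ)..(2 * π), triangleKernel r x y z
  have hr0 : 0 < r := by linarith
  have hc : Continuous fun x => ∫ y in (0 : ℝ)..(2 * π), ∫ z in (0 : ℝ)..(2 * π),
      triangleKernel r x y z :=
    intervalIntegral.continuous_parametric_intervalIntegral_of_continuous'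
      (continuous_integral_triangleKernel r) _ _
  have hδπ : 1 / r ≤ π :=
    ((div_le_one hr0).2 hr).trans (by linarith [Real.pi_gt_three])
  have hI : 2 * π * (4 / (3 * r ^ 2)) ≤ ∫ x in (0:ℝ)..(2 * π),
      ∫ y in (0:ℝ)..(2 * π), ∫ z in (0:ℝ)..(2 * π), triangleKernel r x y z := by
    calc _ = ∫ _ in (0:ℝ)..(2 * π), 4 / (3 * r ^ 2) := by simp [mul_div_assoc]
      _ ≤ _ := by
        refine intervalIntegral.integral_mono_on (by positivity)
          (Continuous.intervalIntegrable (by fun_prop) _ _) (hc.intervalIntegrable _ _)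
          fun x _ => ?_
        refine le_trans (le_of_eq ?_)
          (le_integral_integral_triangleKernel (by positivity : 0 ≤ 1 / r) hδπ x)
        field_simp
        norm_num
  have hs : 3 * π ≤ 8 * Real.sqrt 3 := by
    have h : (3 / 2 : ℝ) ≤ Real.sqrt 3 := Real.le_sqrt_of_sq_le (by norm_num)
    linarith [Real.pi_lt_four]
  calc 1 / (8 * Real.sqrt 3 * π * r ^ 2) ≤ 1 / (3 * π * π * r ^ 2) := by gcongr
    _ = (1 / (2 * π) ^ 3) * (2 * π * (4 / (3 * r ^ 2))) := by
      field_simp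
      norm_num
    _ ≤ _ := by gcongr
end

section
/- For every ε ≥ √2, ∫_{−ε}^{ε} ∫_{−ε}^{ε} exp(−(y² + (y−z)² + z²)/2) dy dz ≥ (2π/√3)·(1 − 2/ε²)². -/
open Real
open MeasureTheory

lemma integrable_quadratic_mul_exp_neg_mul_sq {b : ℝ} (hb : 0 < b) (A B C : ℝ) :
    Integrable fun x : ℝ => (A + B * x + C * x ^ 2) * exp (-b * x ^ 2) := by
  have h0 := (integrable_exp_neg_mul_sq hb).const_mul A
  have h1 := (integrable_mul_exp_neg_mul_sq hb).const_mul B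
  have h2 := (integrable_rpow_mul_exp_neg_mul_sq hb (s := 2) (by norm_num)).const_mul C
  refine ((h0.add h1).add h2).congr (.of_forall fun x => ?_)
  simp only [Pi.add_apply, rpow_two]
  ring

lemma integral_quadratic_mul_exp_neg_mul_sq {b : ℝ} (hb : 0 < b) (A B C : ℝ) :
    ∫ x : ℝ, (A + B * x + C * x ^ 2) * exp (-b * x ^ 2) = √(π / b) * (A + C / (2 * b)) := by
  have hderiv (x : ℝ) :
      HasDerivAt (fun x : ℝ => (-(B / (2 * b)) + -(C / (2 * b)) * x + 0 * x ^ 2) * exp (-b * x ^ 2))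
        ((-(C / (2 * b)) + B * x + C * x ^ 2) * exp (-b * x ^ 2)) x := by
    have hp : HasDerivAt (fun x : ℝ => -(B / (2 * b)) + -(C / (2 * b)) * x + 0 * x ^ 2)
        (-(C / (2 * b))) x := by
      simpa using ((hasDerivAt_id x).const_mul (-(C / (2 * b)))).const_add (-(B / (2 * b)))
    have he : HasDerivAt (fun x : ℝ => exp (-b * x ^ 2))
        (exp (-b * x ^ 2) * (-b * (2 * x))) x := by
      simpa using ((hasDerivAt_pow 2 x).const_mul (-b)).exp
    refine (hp.mul he).congr_deriv ?_
    field_simp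
    ring
  have hzero := integral_eq_zero_of_hasDerivAt_of_integrable hderiv
    (integrable_quadratic_mul_exp_neg_mul_sq hb _ _ _)
    (integrable_quadratic_mul_exp_neg_mul_sq hb _ _ _)
  calc ∫ x : ℝ, (A + B * x + C * x ^ 2) * exp (-b * x ^ 2)
      = ∫ x : ℝ, ((-(C / (2 * b)) + B * x + C * x ^ 2) * exp (-b * x ^ 2)
          + (A + C / (2 * b)) * exp (-b * x ^ 2)) := by
        congr 1 with x
        ring
    _ = √(π / b) * (A + C / (2 * b)) := by
        rw [integral_add (integrable_quadratic_mul_exp_neg_mul_sq hb _ _ _)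
          ((integrable_exp_neg_mul_sq hb).const_mul _), hzero, integral_const_mul,
          integral_gaussian]
        ring

lemma integral_le_intervalIntegral_of_nonpos_outside {f : ℝ → ℝ} {a b : ℝ} (hab : a ≤ b)
    (hf : Integrable f) (hneg : ∀ x ∉ Set.Ioc a b, f x ≤ 0) :
    ∫ x, f x ≤ ∫ x in a..b, f x := by
  rw [intervalIntegral.integral_of_le hab, ← integral_add_compl measurableSet_Ioc hf]
  have := setIntegral_nonpos (μ := volume) (measurableSet_Ioc (a := a) (b := b)).compl hneg
  linarith

lemma sq_le_sq_of_notMem_Ioc_neg {ε x : ℝ} (hε : 0 ≤ ε) (hx : x ∉ Set.Ioc (-ε) ε) :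
    ε ^ 2 ≤ x ^ 2 := by
  rw [Set.mem_Ioc, not_and_or, not_lt, not_le] at hx
  rcases hx with h | h <;> nlinarith

/-- One-variable Chebyshev bound for a slice of the double integral. -/
lemma le_intervalIntegral_exp_neg_quadratic {ε : ℝ} (hε : 0 < ε) (z : ℝ) :
    √π * (((1 - 1 / (2 * ε ^ 2)) + 0 * z + -(5 / (4 * ε ^ 2)) * z ^ 2) * exp (-(3 / 4) * z ^ 2))
      ≤ ∫ y in (-ε)..ε, exp (-(y ^ 2 + (y - z) ^ 2 + z ^ 2) / 2) := by
  set g : ℝ → ℝ := fun x =>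
    ((1 - 5 / (4 * ε ^ 2) * z ^ 2) + -(z / ε ^ 2) * x + -(1 / ε ^ 2) * x ^ 2) * exp (-1 * x ^ 2)
    with hg
  have hg_int : Integrable g := integrable_quadratic_mul_exp_neg_mul_sq one_pos _ _ _
  have hfactor (y : ℝ) : exp (-(3 / 4) * z ^ 2) * g (y - z / 2)
      = (1 - (y ^ 2 + z ^ 2) / ε ^ 2) * exp (-(y ^ 2 + (y - z) ^ 2 + z ^ 2) / 2) := by
    have : exp (-(y ^ 2 + (y - z) ^ 2 + z ^ 2) / 2)
        = exp (-(3 / 4) * z ^ 2) * exp (-1 * (y - z / 2) ^ 2) := by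
      rw [← exp_add]
      congr 1
      ring
    rw [this, hg]
    field_simp
    ring
  have hint : Integrable fun y => exp (-(3 / 4) * z ^ 2) * g (y - z / 2) :=
    (hg_int.comp_sub_right (z / 2)).const_mul _
  calc _ = ∫ y, exp (-(3 / 4) * z ^ 2) * g (y - z / 2) := by
        rw [integral_const_mul, integral_sub_right_eq_self g (z / 2), hg,
          integral_quadratic_mul_exp_neg_mul_sq one_pos, div_one]
        field_simp
        ring
    _ ≤ ∫ y in (-ε)..ε, exp (-(3 / 4) * z ^ 2) * g (y - z / 2) := by
        refine integral_le_intervalIntegral_of_nonpos_outside (by linarith) hint fun y hy => ?_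
        rw [hfactor]
        refine mul_nonpos_of_nonpos_of_nonneg ?_ (exp_pos _).le
        have h1 := sq_le_sq_of_notMem_Ioc_neg hε.le hy
        rw [sub_nonpos, one_le_div (by positivity)]
        nlinarith
    _ ≤ _ := by
        refine intervalIntegral.integral_mono_on (by linarith) hint.intervalIntegrable
          (Continuous.intervalIntegrable (by fun_prop) _ _) fun y _ => ?_
        rw [hfactor]
        refine mul_le_of_le_one_left (exp_pos _).le ?_
        have : 0 ≤ (y ^ 2 + z ^ 2) / ε ^ 2 := by positivity
        linarith

/-- For every `ε ≥ √2`,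
`∫_{−ε}^{ε} ∫_{−ε}^{ε} exp(−(y² + (y−z)² + z²)/2) dy dz ≥ (2π/√3)·(1 − 2/ε²)²`. -/
theorem flattened_triangle_double_integral_lower_bound (ε : ℝ) (hε : Real.sqrt 2 ≤ ε) :
    (∫ z in (-ε)..ε, ∫ y in (-ε)..ε,
        Real.exp (-(y ^ 2 + (y - z) ^ 2 + z ^ 2) / 2))
      ≥ (2 * π / Real.sqrt 3) * (1 - 2 / ε ^ 2) ^ 2 := by
  have hpos : 0 < ε := lt_of_lt_of_le (by positivity) hε
  have hsq : 2 ≤ ε ^ 2 := (sqrt_le_left hpos.le).1 hε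
  have h34 : (0 : ℝ) < 3 / 4 := by norm_num
  have hint := (integrable_quadratic_mul_exp_neg_mul_sq h34
    (1 - 1 / (2 * ε ^ 2)) 0 (-(5 / (4 * ε ^ 2)))).const_mul √π
  have hconst : √π * √(π / (3 / 4)) = 2 * π / √3 := by
    rw [show π / (3 / 4) = 2 ^ 2 * π / 3 by ring, sqrt_div (by positivity),
      sqrt_mul (by positivity), sqrt_sq (by norm_num)]
    calc _ = 2 * (√π * √π) / √3 := by ring
      _ = _ := by rw [mul_self_sqrt pi_pos.le]
  calc (2 * π / √3) * (1 - 2 / ε ^ 2) ^ 2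
      ≤ (2 * π / √3) * (1 - 4 / (3 * ε ^ 2)) := by
        refine mul_le_mul_of_nonneg_left ?_ (by positivity)
        have ht : 1 / ε ^ 2 ≤ 1 / 2 := one_div_le_one_div_of_le two_pos hsq
        have ht0 : 0 ≤ 1 / ε ^ 2 := by positivity
        rw [show 2 / ε ^ 2 = 2 * (1 / ε ^ 2) by ring,
          show 4 / (3 * ε ^ 2) = 4 / 3 * (1 / ε ^ 2) by field_simp]
        nlinarith
    _ = ∫ z, √π * (((1 - 1 / (2 * ε ^ 2)) + 0 * z + -(5 / (4 * ε ^ 2)) * z ^ 2)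
          * exp (-(3 / 4) * z ^ 2)) := by
        rw [integral_const_mul, integral_quadratic_mul_exp_neg_mul_sq h34, ← mul_assoc, hconst]
        field_simp
        ring
    _ ≤ ∫ z in (-ε)..ε, √π * (((1 - 1 / (2 * ε ^ 2)) + 0 * z + -(5 / (4 * ε ^ 2)) * z ^ 2)
          * exp (-(3 / 4) * z ^ 2)) := by
        refine integral_le_intervalIntegral_of_nonpos_outside (by linarith) hint fun z hz => ?_
        refine mul_nonpos_of_nonneg_of_nonpos (sqrt_nonneg _)
          (mul_nonpos_of_nonpos_of_nonneg ?_ (exp_pos _).le)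
        have h1 := sq_le_sq_of_notMem_Ioc_neg hpos.le hz
        rw [show 1 - 1 / (2 * ε ^ 2) + 0 * z + -(5 / (4 * ε ^ 2)) * z ^ 2
          = (ε ^ 2 - 1 / 2 - 5 / 4 * z ^ 2) / ε ^ 2 by field_simp; ring]
        exact div_nonpos_of_nonpos_of_nonneg (by nlinarith) (sq_nonneg _)
    _ ≤ _ := by
        refine intervalIntegral.integral_mono_on (by linarith) hint.intervalIntegrable
          (Continuous.intervalIntegrable ?_ _ _)
          fun z _ => le_intervalIntegral_exp_neg_quadratic hpos z
        exact intervalIntegral.continuous_parametric_intervalIntegral_of_continuous'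
          (by fun_prop) _ _
end

section
/- Let H be a real inner product space and let φ : ℝ → H satisfy ⟨φ(x), φ(y)⟩ = exp(−(x−y)²/2) for all x, y ∈ ℝ. If φ has derivative v ∈ H at a point x ∈ ℝ, then ‖v‖ = 1. -/
open scoped RealInnerProductSpace

/-- The derivative of the Gaussian kernel in its first variable. -/
theorem hasDerivAt_gaussian_kernel (x y : ℝ) :
    HasDerivAt (fun t => Real.exp (-(t - y) ^ 2 / 2))
      ((y - x) * Real.exp (-(x - y) ^ 2 / 2)) x := by
  convert ((((hasDerivAt_id' x).sub_const y).fun_pow 2).fun_neg.div_const 2).exp using 1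
  simp
  ring

/-- A feature map `φ : ℝ → H` of the Gaussian RBF kernel
(`⟪φ(x), φ(y)⟫ = exp(−(x−y)²/2)`) has unit speed: if `φ` has derivative `v` at `x`, then
`‖v‖ = 1`. -/
theorem rbf_feature_map_unit_speed {H : Type*} [NormedAddCommGroup H]
    [InnerProductSpace ℝ H] (φ : ℝ → H)
    (hφ : ∀ x y : ℝ, ⟪φ x, φ y⟫ = Real.exp (-(x - y) ^ 2 / 2))
    (x : ℝ) (v : H) (hv : HasDerivAt φ v x) :
    ‖v‖ = 1 := by
  have hvφ (y : ℝ) : ⟪v, φ y⟫ = (y - x) * Real.exp (-(x - y) ^ 2 / 2) := by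
    have h : HasDerivAt (fun t => ⟪φ t, φ y⟫) ⟪v, φ y⟫ x := by
      simpa using hv.inner ℝ (hasDerivAt_const x (φ y))
    simp only [hφ] at h
    exact h.unique (hasDerivAt_gaussian_kernel x y)
  have h : HasDerivAt (fun y => ⟪v, φ y⟫) ⟪v, v⟫ x := by
    simpa using (hasDerivAt_const x v).inner ℝ hv
  simp only [hvφ] at h
  have hg : HasDerivAt (fun y => (y - x) * Real.exp (-(x - y) ^ 2 / 2)) 1 x := by
    have hexp : HasDerivAt (fun y => Real.exp (-(x - y) ^ 2 / 2)) 0 x := by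
      simpa only [sub_sq_comm x, sub_self, zero_mul] using hasDerivAt_gaussian_kernel x x
    simpa using ((hasDerivAt_id' x).sub_const x).fun_mul hexp
  have hinner : ⟪v, v⟫ = 1 := h.unique hg
  rw [real_inner_self_eq_norm_sq] at hinner
  exact (pow_eq_one_iff_of_nonneg (norm_nonneg v) two_ne_zero).mp hinner
end

section
/- Let H be a real inner product space and let φ : ℝ → H satisfy ⟨φ(x), φ(y)⟩ = exp(−(x−y)²/2) for all x, y ∈ ℝ, and suppose φ is differentiable on ℝ. Then for every differentiable curve η : ℝ → ℝ, ∫_0^1 ‖(φ∘η)'(t)‖ dt = ∫_0^1 |η'(t)| dt; that is, the length of the image curve φ∘η equals the length of η. -/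
open scoped RealInnerProductSpace

/-- A differentiable feature map of the Gaussian kernel has unit speed. -/
theorem norm_deriv_of_inner_eq_gaussian {H : Type*} [NormedAddCommGroup H]
    [InnerProductSpace ℝ H] {φ : ℝ → H}
    (hφ : ∀ x y : ℝ, ⟪φ x, φ y⟫ = Real.exp (-(x - y) ^ 2 / 2))
    (hdiff : Differentiable ℝ φ) (x : ℝ) : ‖deriv φ x‖ = 1 := by
  have hfirst (y : ℝ) : ⟪deriv φ x, φ y⟫ = Real.exp (-(x - y) ^ 2 / 2) * -(x - y) := by
    have h1 : HasDerivAt (fun z => ⟪φ z, φ y⟫) ⟪deriv φ x, φ y⟫ x := by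
      simpa using (hdiff x).hasDerivAt.inner ℝ (hasDerivAt_const x (φ y))
    simp only [hφ] at h1
    have h2 : HasDerivAt (fun z : ℝ => -(z - y) ^ 2 / 2) (-(x - y)) x := by
      refine ((((hasDerivAt_id' x).sub_const y).pow 2).neg.div_const 2).congr_deriv ?_
      norm_num
      ring
    exact h1.unique h2.exp
  have h1 : HasDerivAt (fun y => ⟪deriv φ x, φ y⟫) ⟪deriv φ x, deriv φ x⟫ x := by
    simpa using (hasDerivAt_const x (deriv φ x)).inner ℝ (hdiff x).hasDerivAt
  simp only [hfirst] at h1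
  have hlin : HasDerivAt (fun y : ℝ => -(x - y)) 1 x :=
    ((hasDerivAt_id' x).const_sub x).neg.congr_deriv (neg_neg 1)
  have hexp : HasDerivAt (fun y : ℝ => -(x - y) ^ 2 / 2) 0 x := by
    refine ((((hasDerivAt_id' x).const_sub x).pow 2).neg.div_const 2).congr_deriv ?_
    simp
  have h := h1.unique (hexp.exp.mul hlin)
  rw [real_inner_self_eq_norm_sq] at h
  exact (pow_eq_one_iff_of_nonneg (norm_nonneg _) two_ne_zero).mp (by simpa using h)

/-- A differentiable feature map `φ : ℝ → H` of the Gaussian RBF kernel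
(`⟪φ(x), φ(y)⟫ = exp(−(x−y)²/2)`) is non-distortive: for every differentiable curve
`η : ℝ → ℝ`, the length of `φ ∘ η` over `[0,1]` equals the length of `η` over `[0,1]`. -/
theorem rbf_feature_map_nondistortive {H : Type*} [NormedAddCommGroup H]
    [InnerProductSpace ℝ H] (φ : ℝ → H)
    (hφ : ∀ x y : ℝ, ⟪φ x, φ y⟫ = Real.exp (-(x - y) ^ 2 / 2))
    (hdiff : Differentiable ℝ φ) :
    ∀ η : ℝ → ℝ, Differentiable ℝ η →
      (∫ t in (0:ℝ)..1, ‖deriv (φ ∘ η) t‖) = ∫ t in (0:ℝ)..1, |deriv η t| := by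
  intro η hη
  congr 1
  ext t
  have h : deriv (φ ∘ η) t = deriv η t • deriv φ (η t) :=
    ((hdiff (η t)).hasDerivAt.scomp t (hη t).hasDerivAt).deriv
  rw [h, norm_smul, norm_deriv_of_inner_eq_gaussian hφ hdiff, mul_one, Real.norm_eq_abs]
end

section
/- Let n, m, D, d be positive integers, let X be a real n × D matrix with rank(X) = D, and let C : Fin m → Fin n be a selection of row indices with X^C the m × D matrix whose i-th row is row C(i) of X. Let Y be a real m × d matrix and Z a real n × d matrix such that X^C · Xᵀ = Y · Zᵀ. Then Xᵀ·X is invertible and X^C = Y · (Zᵀ · X · (Xᵀ·X)^{−1}). -/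
open Matrix

/-- If `X` is an `n × D` real matrix of full column rank `D`, `C` selects `m` rows of `X`
(with `X^C` the corresponding `m × D` submatrix), and `X^C·Xᵀ = Y·Zᵀ` is any factorisation of
the core-periphery slice, then `Xᵀ·X` is invertible and
`X^C = Y·(Zᵀ·X·(Xᵀ·X)⁻¹)`, i.e. the core latent positions are a linear transformation of
`Y`. -/
theorem core_periphery_slice_recovery (n m D d : ℕ) (hn : 0 < n) (hm : 0 < m)
    (hD : 0 < D) (hd : 0 < d)
    (X : Matrix (Fin n) (Fin D) ℝ) (hrank : X.rank = D)
    (C : Fin m → Fin n)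
    (Y : Matrix (Fin m) (Fin d) ℝ) (Z : Matrix (Fin n) (Fin d) ℝ)
    (hfact : X.submatrix C id * Xᵀ = Y * Zᵀ) :
    IsUnit (Xᵀ * X) ∧ X.submatrix C id = Y * (Zᵀ * X * (Xᵀ * X)⁻¹) := by
  have hunit : IsUnit (Xᵀ * X) := by
    rw [← Matrix.mulVec_surjective_iff_isUnit]
    have hr : (Xᵀ * X).rank = D := by rw [Matrix.rank_transpose_mul_self, hrank]
    have htop : LinearMap.range (Xᵀ * X).mulVecLin = ⊤ :=
      Submodule.eq_top_of_finrank_eq (by simpa [Matrix.rank] using hr)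
    exact LinearMap.range_eq_top.mp htop
  refine ⟨hunit, ?_⟩
  rw [← Matrix.mul_assoc, ← Matrix.mul_assoc, ← hfact, Matrix.mul_assoc _ Xᵀ X,
    Matrix.mul_nonsing_inv_cancel_right _ _ ((Matrix.isUnit_iff_isUnit_det _).mp hunit)]
end
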